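/- arXiv:cs/0310065 — 2 statements merged into one kernel-verified Lean document; each statement's English description precedes it below -/
import Mathlib

section
/- Let T be a finite tree with positive edge weights, and let A and B be subtrees of T such that A ∪ B = T and A ∩ B consists of a single vertex c. If max_dist(A,c) ≥ max_dist(B,c), then for every vertex v of B different from c one has max_dist(T,v) > max_dist(T,c); in particular no such v is a center of T. -/
open SimpleGraph

/-- The maximal distance from `v` to a vertex of the set `S`, with respect to the
distance function `d` (supremum of a finite nonempty set of reals). -/
noncomputable def maxDist {V : Type*} (d : V → V → ℝ) (S : Set V) (v : V) : ℝ :=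
  sSup (d v '' S)

/-- A connected subgraph contains a path between any two of its vertices. -/
theorem SimpleGraph.Subgraph.Connected.exists_path_support_subset {V : Type*}
    {G : SimpleGraph V} {H : G.Subgraph} (hH : H.Connected) {u v : V}
    (hu : u ∈ H.verts) (hv : v ∈ H.verts) :
    ∃ p : G.Walk u v, p.IsPath ∧ ∀ x ∈ p.support, x ∈ H.verts := by
  obtain ⟨p, hp⟩ := (hH.coe.preconnected ⟨u, hu⟩ ⟨v, hv⟩).exists_isPath
  refine ⟨p.map H.hom, hp.map Subgraph.hom_injective, ?_⟩
  intro x hx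
  obtain ⟨y, -, rfl⟩ := List.mem_map.mp (p.support_map H.hom ▸ hx)
  exact y.2

/-- Two paths that meet only in their common endpoint concatenate to a path. -/
theorem SimpleGraph.Walk.IsPath.append_of_support_inter {V : Type*} {G : SimpleGraph V}
    {u v w : V} {p : G.Walk u v} {q : G.Walk v w} (hp : p.IsPath) (hq : q.IsPath)
    (h : ∀ x ∈ p.support, x ∈ q.support → x = v) : (p.append q).IsPath := by
  rw [Walk.isPath_def, Walk.support_append, List.nodup_append]
  have hnd := hq.support_nodup
  rw [← Walk.cons_tail_support, List.nodup_cons] at hnd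
  refine ⟨hp.support_nodup, hnd.2, ?_⟩
  rintro x hx y hy rfl
  exact hnd.1 (h x hx (List.mem_of_mem_tail hy) ▸ hy)

/-- The total weight of a nontrivial walk is positive if all edge weights are. -/
theorem SimpleGraph.Walk.sum_edges_pos {V : Type*} {G : SimpleGraph V} {ew : Sym2 V → ℝ}
    (hew : ∀ e ∈ G.edgeSet, 0 < ew e) {u v : V} (p : G.Walk u v) (huv : u ≠ v) :
    0 < (p.edges.map ew).sum := by
  apply List.sum_pos
  · intro x hx
    obtain ⟨e, he, rfl⟩ := List.mem_map.mp hx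
    exact hew e (p.edges_subset_edgeSet he)
  · cases p with
    | nil => exact absurd rfl huv
    | cons h p => simp

/-- The maximal distance to a vertex of `S` bounds every distance to a vertex of `S`. -/
theorem le_maxDist {V : Type*} [Finite V] (d : V → V → ℝ) {S : Set V} (v : V) {u : V}
    (hu : u ∈ S) : d v u ≤ maxDist d S v :=
  le_csSup (Set.toFinite _).bddAbove (Set.mem_image_of_mem _ hu)

/-- The maximal distance to a vertex of a nonempty set is attained. -/
theorem exists_maxDist_eq {V : Type*} [Finite V] (d : V → V → ℝ) {S : Set V}
    (hS : S.Nonempty) (v : V) : ∃ u ∈ S, d v u = maxDist d S v :=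
  (hS.image (d v)).csSup_mem (Set.toFinite _)

/-- Let `T` be a finite tree with positive edge weights, and let `A`, `B` be subtrees
(connected subgraphs) with `A ∪ B = T` and `A ∩ B = {c}`.  If
`max_dist(A,c) ≥ max_dist(B,c)`, then every vertex `v` of `B` different from `c`
satisfies `max_dist(T,v) > max_dist(T,c)`; in particular no such `v` is a center. -/
theorem eccentricity_strict_on_lighter_side {V : Type*} [Fintype V]
    (T : SimpleGraph V) (hT : T.IsTree)
    (ew : Sym2 V → ℝ) (hew : ∀ e ∈ T.edgeSet, 0 < ew e)
    (d : V → V → ℝ)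
    (hd : ∀ (u v : V) (p : T.Path u v), d u v = ((p : T.Walk u v).edges.map ew).sum)
    (A B : T.Subgraph) (hAconn : A.Connected) (hBconn : B.Connected)
    (hUnion : A ⊔ B = ⊤) (c : V) (hInter : (A ⊓ B).verts = {c})
    (hmax : maxDist d B.verts c ≤ maxDist d A.verts c) :
    ∀ v ∈ B.verts, v ≠ c →
      maxDist d Set.univ c < maxDist d Set.univ v ∧
      ¬ (∀ u : V, maxDist d Set.univ v ≤ maxDist d Set.univ u) := by
  intro v hv hvc
  have hc : c ∈ A.verts ∩ B.verts := by
    rw [← Subgraph.verts_inf, hInter]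
    rfl
  obtain ⟨a, ha, hda⟩ := exists_maxDist_eq d ⟨c, hc.1⟩ c
  have hle : maxDist d Set.univ c ≤ d c a := by
    obtain ⟨u, -, hu⟩ := exists_maxDist_eq d ⟨c, Set.mem_univ c⟩ c
    rw [← hu, hda]
    have huAB : u ∈ A.verts ∪ B.verts := by
      rw [← Subgraph.verts_sup, hUnion]
      trivial
    rcases huAB with h | h
    · exact le_maxDist d c h
    · exact (le_maxDist d c h).trans hmax
  obtain ⟨p, hp, hpB⟩ := hBconn.exists_path_support_subset hv hc.2
  obtain ⟨q, hq, hqA⟩ := hAconn.exists_path_support_subset hc.1 ha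
  have hpq : (p.append q).IsPath := hp.append_of_support_inter hq fun x hxp hxq => by
    have hx : x ∈ (A ⊓ B).verts := ⟨hqA x hxq, hpB x hxp⟩
    rwa [hInter] at hx
  have hadd : d v a = (p.edges.map ew).sum + d c a := by
    rw [hd v a ⟨_, hpq⟩, hd c a ⟨q, hq⟩, Walk.edges_append, List.map_append, List.sum_append]
  have hpos := p.sum_edges_pos hew hvc
  have hva := le_maxDist d v (Set.mem_univ a)
  have hlt : maxDist d Set.univ c < maxDist d Set.univ v := by linarith
  exact ⟨hlt, fun h => (h c).not_gt hlt⟩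
end

section
/- Let T be a finite tree with positive edge weights and real vertex weights, let (v,w) be an edge of T of weight ℓ, and let T_v and T_w be the two components of T with the edge (v,w) removed, containing v and w respectively. Then (Σ_u weight(u)·dist(u,w)) − (Σ_u weight(u)·dist(u,v)) = ℓ·(vert_weight(T_v) − vert_weight(T_w)), where both sums range over all vertices u of T. -/
open SimpleGraph

/-- The median cost of vertex `m`: the sum over all vertices `u` of
`weight(u) · dist(u,m)`. -/
noncomputable def medianCost {V : Type*} [Fintype V] (vw : V → ℝ) (d : V → V → ℝ)
    (m : V) : ℝ :=
  ∑ u : V, vw u * d u m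

open Classical in
/-- The total vertex weight of the connected component of `x` in the graph `G`. -/
noncomputable def compWeight {V : Type*} [Fintype V] (G : SimpleGraph V) (vw : V → ℝ)
    (x : V) : ℝ :=
  ∑ u : V, if G.Reachable u x then vw u else 0

/-- If `u` lies on the `v`-side of a removed edge `s(v, w)`, then any path-length function
increases by the weight of the edge when passing from `v` to `w`. -/
theorem pathLength_eq_add_of_reachable_deleteEdges {V : Type*} {G : SimpleGraph V}
    {ew : Sym2 V → ℝ} {d : V → V → ℝ}
    (hd : ∀ (u v : V) (p : G.Path u v), d u v = ((p : G.Walk u v).edges.map ew).sum)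
    {u v w : V} (hadj : G.Adj v w)
    (hv : (G.deleteEdges {s(v, w)}).Reachable u v)
    (hw : ¬ (G.deleteEdges {s(v, w)}).Reachable u w) :
    d u w = d u v + ew s(v, w) := by
  classical
  obtain ⟨p, hp⟩ := hv.exists_isPath
  have hsupp : w ∉ p.support := fun h => hw ⟨p.takeUntil w h⟩
  have hle : G.deleteEdges {s(v, w)} ≤ G := G.deleteEdges_le _
  have hq : (p.mapLe hle).IsPath := hp.mapLe hle
  have hq' : ((p.mapLe hle).concat hadj).IsPath := hq.concat (by simpa using hsupp) hadj
  rw [hd u v ⟨_, hq⟩, hd u w ⟨_, hq'⟩]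
  simp [Walk.edges_concat]

/-- In a connected graph, every vertex remains connected to one of the endpoints of a removed
edge. -/
theorem SimpleGraph.Connected.reachable_deleteEdges_or {V : Type*} {G : SimpleGraph V}
    (hG : G.Connected) {v w : V} (hne : v ≠ w) (u : V) :
    (G.deleteEdges {s(v, w)}).Reachable u v ∨ (G.deleteEdges {s(v, w)}).Reachable u w := by
  classical
  obtain ⟨p, hp⟩ := (hG.preconnected u v).exists_isPath
  by_cases hw : w ∈ p.support
  · right
    have hv := Walk.endpoint_notMem_support_takeUntil hp hw hne
    exact ⟨(p.takeUntil w hw).toDeleteEdge s(v, w)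
      fun h => hv (Walk.fst_mem_support_of_mem_edges _ h)⟩
  · left
    exact ⟨p.toDeleteEdge s(v, w) fun h => hw (Walk.snd_mem_support_of_mem_edges _ h)⟩

/-- Let `T` be a finite tree with positive edge weights and real vertex weights,
`(v,w)` an edge of `T` of weight `ℓ`, and `T_v`, `T_w` the two components of `T` minus
the edge `(v,w)`.  Then
`(Σ_u weight(u)·dist(u,w)) − (Σ_u weight(u)·dist(u,v)) = ℓ·(vert_weight(T_v) − vert_weight(T_w))`. -/
theorem medianCost_difference_across_edge {V : Type*} [Fintype V]
    (T : SimpleGraph V) (hT : T.IsTree)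
    (ew : Sym2 V → ℝ) (hew : ∀ e ∈ T.edgeSet, 0 < ew e)
    (vw : V → ℝ)
    (d : V → V → ℝ)
    (hd : ∀ (u v : V) (p : T.Path u v), d u v = ((p : T.Walk u v).edges.map ew).sum)
    (v w : V) (hadj : T.Adj v w) :
    medianCost vw d w - medianCost vw d v
      = ew s(v, w) * (compWeight (T.deleteEdges {s(v, w)}) vw v
          - compWeight (T.deleteEdges {s(v, w)}) vw w) := by
  have hbridge : ¬ (T.deleteEdges {s(v, w)}).Reachable v w :=
    isBridge_iff.mp (isAcyclic_iff_forall_isBridge.mp hT.isAcyclic hadj)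
  simp only [medianCost, compWeight, ← Finset.sum_sub_distrib, Finset.mul_sum]
  refine Finset.sum_congr rfl fun u _ => ?_
  by_cases hv : (T.deleteEdges {s(v, w)}).Reachable u v
  · have hw : ¬ (T.deleteEdges {s(v, w)}).Reachable u w := fun h => hbridge (hv.symm.trans h)
    rw [if_pos hv, if_neg hw, pathLength_eq_add_of_reachable_deleteEdges hd hadj hv hw]
    ring
  · have hw := (hT.connected.reachable_deleteEdges_or hadj.ne u).resolve_left hv
    rw [if_neg hv, if_pos hw]
    rw [Sym2.eq_swap] at hv hw
    rw [pathLength_eq_add_of_reachable_deleteEdges hd hadj.symm hw hv, Sym2.eq_swap]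
    ring
end
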